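/- Suppose the linear operator D maps compactly supported sections to compactly supported sections and commutes with the action of Γ. Then D has finite propagation speed: there exists R > 0 such that supp(Dφ) ⊆ U_R(supp φ) for every compactly supported section φ. -/

import Mathlib

open scoped BigOperators
open Filter

noncomputable section

variable {Y Γ V : Type*}

section Defs

variable [Group Γ] [MulAction Γ Y]
variable [NormedAddCommGroup V] [InnerProductSpace ℂ V]

/-- The action of `γ ∈ Γ` on compactly (= finitely) supported sections
`φ : Y →₀ V`, given by `(γ · φ)(y) = ρ(γ) φ(γ⁻¹ • y)`. -/
def secAct (ρ : Γ →* (V ≃ₗᵢ[ℂ] V)) (γ : Γ) (φ : Y →₀ V) : Y →₀ V :=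
  Finsupp.equivMapDomain (MulAction.toPerm γ) (φ.mapRange (ρ γ) ((ρ γ).map_zero))

/-- A linear operator on compactly supported sections is `Γ`-invariant if it
commutes with the action of `Γ`. -/
def IsEquivariantOp (ρ : Γ →* (V ≃ₗᵢ[ℂ] V)) (D : (Y →₀ V) →ₗ[ℂ] (Y →₀ V)) : Prop :=
  ∀ (γ : Γ) (φ : Y →₀ V), D (secAct ρ γ φ) = secAct ρ γ (D φ)

/-- The kernel `⟨x|D|y⟩ ∈ End(V)` of an operator `D`, characterized by
`⟨x|D|y⟩ v = (D δ_{y,v})(x)`. -/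
def kernelOf (D : (Y →₀ V) →ₗ[ℂ] (Y →₀ V)) (x y : Y) : V →ₗ[ℂ] V :=
  (Finsupp.lapply x) ∘ₗ D ∘ₗ (Finsupp.lsingle y)

/-- `D` has finite propagation speed `≤ R`:
`supp (Dφ) ⊆ U_R(supp φ) = {x | ∃ y ∈ supp φ, d(x,y) ≤ R}`. -/
def HasPropSpeed [MetricSpace Y] (D : (Y →₀ V) →ₗ[ℂ] (Y →₀ V)) (R : ℝ) : Prop :=
  ∀ (φ : Y →₀ V) (x : Y), D φ x ≠ 0 → ∃ y ∈ φ.support, dist x y ≤ R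

/-- A set of representatives of the orbits of a group `G` acting on `Y`:
it contains exactly one point of every orbit. -/
def IsRepSet (G : Type*) [Group G] [MulAction G Y] (S : Set Y) : Prop :=
  ∀ y : Y, ∃! s, s ∈ S ∧ s ∈ MulAction.orbit G y

/-- The space `W_{Γ'}` of `Γ'`-equivariant functions `f : Y → V`,
i.e. `f(γ • y) = ρ(γ) f(y)` for all `γ ∈ Γ'`. -/
def equivSubmodule (ρ : Γ →* (V ≃ₗᵢ[ℂ] V)) (Γ' : Subgroup Γ) : Submodule ℂ (Y → V) where
  carrier := {f | ∀ (γ : Γ') (y : Y), f ((γ : Γ) • y) = ρ (γ : Γ) (f y)}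
  add_mem' := by intro f g hf hg γ y; simp only [Pi.add_apply, hf γ y, hg γ y, map_add]
  zero_mem' := by intro γ y; simp
  smul_mem' := by intro c f hf γ y; simp only [Pi.smul_apply, hf γ y, map_smul]

/-- The summation map `S_{Γ'} φ (y) = Σ_{γ ∈ Γ'} ρ(γ)⁻¹ φ(γ • y)`. -/
def smap (ρ : Γ →* (V ≃ₗᵢ[ℂ] V)) (Γ' : Subgroup Γ) (φ : Y →₀ V) : Y → V :=
  fun y => ∑ᶠ γ : Γ', ρ ((γ : Γ)⁻¹) (φ ((γ : Γ) • y))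

/-- `DG` is the pushdown of `D` to `W_{Γ'}`, i.e. `DG ∘ S_{Γ'} = S_{Γ'} ∘ D`. -/
def IsPushdown (ρ : Γ →* (V ≃ₗᵢ[ℂ] V)) (Γ' : Subgroup Γ)
    (D : (Y →₀ V) →ₗ[ℂ] (Y →₀ V))
    (DG : equivSubmodule (Y := Y) ρ Γ' →ₗ[ℂ] equivSubmodule (Y := Y) ρ Γ') : Prop :=
  ∀ (w : equivSubmodule (Y := Y) ρ Γ') (φ : Y →₀ V),
    (w : Y → V) = smap ρ Γ' φ → ((DG w : Y → V) = smap ρ Γ' (D φ))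

/-- The kernel `⟨x|D|y⟩`, as a continuous linear map on `V`. -/
def kernelOfL [FiniteDimensional ℂ V] (D : (Y →₀ V) →ₗ[ℂ] (Y →₀ V)) (x y : Y) : V →L[ℂ] V :=
  LinearMap.toContinuousLinearMap (kernelOf D x y)

/-- The heat kernel `⟨x|e^{zD}|y⟩ = Σ_{n ≥ 0} (zⁿ/n!) ⟨x|Dⁿ|y⟩`. -/
def heatKer [FiniteDimensional ℂ V] (D : (Y →₀ V) →ₗ[ℂ] (Y →₀ V)) (z : ℂ) (x y : Y) :
    V →L[ℂ] V :=
  ∑' n : ℕ, (z ^ n / (n.factorial : ℂ)) • kernelOfL (D ^ n) x y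

/-- The `Γ`-trace `tr_Γ e^{zD} = Σ_{s ∈ S} tr ⟨s|e^{zD}|s⟩`,
for a set `S` of representatives of the `Γ`-orbits. -/
def trGammaHeat [FiniteDimensional ℂ V] (D : (Y →₀ V) →ₗ[ℂ] (Y →₀ V)) (z : ℂ)
    (S : Set Y) : ℂ :=
  ∑ᶠ s ∈ S, LinearMap.trace ℂ V ((heatKer D z s s : V →L[ℂ] V) : V →ₗ[ℂ] V)

/-- `tr e^{zT}` for an endomorphism `T` of a finite dimensional space,
via the exponential series `Σ_{n ≥ 0} (zⁿ/n!) tr(Tⁿ)`. -/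
def trExp {W : Type*} [AddCommGroup W] [Module ℂ W] (T : W →ₗ[ℂ] W) (z : ℂ) : ℂ :=
  ∑' n : ℕ, z ^ n / (n.factorial : ℂ) * LinearMap.trace ℂ W (T ^ n)

end Defs

/-- A single fibre of finite dimension is moved only a bounded distance by a linear operator. -/
theorem exists_dist_le_of_single [MetricSpace Y]
    [NormedAddCommGroup V] [InnerProductSpace ℂ V] [FiniteDimensional ℂ V]
    (D : (Y →₀ V) →ₗ[ℂ] (Y →₀ V)) (y : Y) :
    ∃ R : ℝ, ∀ (v : V) (x : Y), D (Finsupp.single y v) x ≠ 0 → dist x y ≤ R := by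
  classical
  let b := Module.finBasis ℂ V
  let S : Finset Y := Finset.univ.biUnion fun i => (D (Finsupp.single y (b i))).support
  obtain ⟨R, hR⟩ := (S.image fun x => dist x y).bddAbove
  refine ⟨R, fun v x hx => hR ?_⟩
  suffices x ∈ S from Finset.mem_coe.2 (Finset.mem_image_of_mem _ this)
  by_contra hxS
  have hzero : kernelOf D x y = 0 := b.ext fun i => by
    by_contra hi
    exact hxS (Finset.mem_biUnion.2 ⟨i, Finset.mem_univ i, Finsupp.mem_support_iff.2 hi⟩)
  exact hx (LinearMap.congr_fun hzero v)

theorem secAct_apply [Group Γ] [MulAction Γ Y]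
    [NormedAddCommGroup V] [InnerProductSpace ℂ V]
    (ρ : Γ →* (V ≃ₗᵢ[ℂ] V)) (γ : Γ) (φ : Y →₀ V) (y : Y) :
    secAct ρ γ φ y = ρ γ (φ (γ⁻¹ • y)) := by
  simp [secAct, Finsupp.equivMapDomain_apply, MulAction.toPerm_symm_apply]

theorem secAct_single [Group Γ] [MulAction Γ Y]
    [NormedAddCommGroup V] [InnerProductSpace ℂ V]
    (ρ : Γ →* (V ≃ₗᵢ[ℂ] V)) (γ : Γ) (y : Y) (v : V) :
    secAct ρ γ (Finsupp.single y v) = Finsupp.single (γ • y) (ρ γ v) := by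
  simp [secAct, Finsupp.equivMapDomain_single]

/-- The propagation bound of an invariant operator at `y` also holds along the orbit of `y`. -/
theorem IsEquivariantOp.dist_le_smul [MetricSpace Y] [Group Γ] [MulAction Γ Y]
    [NormedAddCommGroup V] [InnerProductSpace ℂ V]
    {ρ : Γ →* (V ≃ₗᵢ[ℂ] V)} {D : (Y →₀ V) →ₗ[ℂ] (Y →₀ V)} (hinv : IsEquivariantOp ρ D)
    (hiso : ∀ γ : Γ, Isometry (fun y : Y => γ • y)) {y : Y} {R : ℝ}
    (hR : ∀ (v : V) (x : Y), D (Finsupp.single y v) x ≠ 0 → dist x y ≤ R)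
    (γ : Γ) (v : V) (x : Y) (hx : D (Finsupp.single (γ • y) v) x ≠ 0) :
    dist x (γ • y) ≤ R := by
  have hv : Finsupp.single (γ • y) v = secAct ρ γ (Finsupp.single y ((ρ γ).symm v)) := by
    simp [secAct_single]
  rw [hv, hinv, secAct_apply] at hx
  have h := hR _ (γ⁻¹ • x) fun h => hx (by rw [h, map_zero])
  rwa [← (hiso γ).dist_eq, smul_inv_smul] at h

/-- A bound on the propagation of sections supported at one point is a bound on the propagation
speed. -/
theorem hasPropSpeed_of_single [MetricSpace Y]
    [NormedAddCommGroup V] [InnerProductSpace ℂ V]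
    {D : (Y →₀ V) →ₗ[ℂ] (Y →₀ V)} {R : ℝ}
    (hR : ∀ (y : Y) (v : V) (x : Y), D (Finsupp.single y v) x ≠ 0 → dist x y ≤ R) :
    HasPropSpeed D R := by
  intro φ x hx
  rw [← φ.sum_single, Finsupp.sum, map_sum, Finsupp.finsetSum_apply] at hx
  obtain ⟨y, hy, hyx⟩ := Finset.exists_ne_zero_of_sum_ne_zero hx
  exact ⟨y, hy, hR y _ x hyx⟩

/-- Suppose the linear operator `D` maps compactly supported sections to compactly
supported sections and commutes with the action of `Γ`.  Then `D` has finite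
propagation speed: there is `R > 0` with `supp (Dφ) ⊆ U_R(supp φ)` for all `φ`. -/
theorem invariant_op_has_finite_propagation_speed
    [MetricSpace Y] [Group Γ] [MulAction Γ Y]
    [NormedAddCommGroup V] [InnerProductSpace ℂ V] [FiniteDimensional ℂ V]
    (hball : ∀ (y : Y) (R : ℝ), (Metric.closedBall y R).Finite)
    (hiso : ∀ γ : Γ, Isometry (fun y : Y => γ • y))
    (hfree : ∀ (γ : Γ) (y : Y), γ • y = y → γ = 1)
    (horb : Finite (MulAction.orbitRel.Quotient Γ Y))
    (ρ : Γ →* (V ≃ₗᵢ[ℂ] V))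
    (D : (Y →₀ V) →ₗ[ℂ] (Y →₀ V))
    (hinv : IsEquivariantOp ρ D) :
    ∃ R : ℝ, 0 < R ∧ HasPropSpeed D R := by
  choose r hr using exists_dist_le_of_single D
  obtain ⟨R, hR⟩ := (Set.finite_range
    fun q : MulAction.orbitRel.Quotient Γ Y => r q.out).bddAbove
  refine ⟨max R 1, lt_max_of_lt_right one_pos, hasPropSpeed_of_single fun y v x hx => ?_⟩
  obtain ⟨γ, hγ⟩ : ∃ γ : Γ, γ • (Quotient.mk (MulAction.orbitRel Γ Y) y).out = y :=
    MulAction.orbitRel_apply.1 ((MulAction.orbitRel Γ Y).symm (Quotient.mk_out y))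
  rw [← hγ] at hx ⊢
  exact (hinv.dist_le_smul hiso (hr _) γ v x hx).trans
    ((hR (Set.mem_range_self _)).trans (le_max_left _ _))
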